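/- Let G be a connected finite simple graph on n vertices with diameter exactly 2, and let C* = min{ |N(v) ∩ N(w)| : v, w vertices of G with dist_G(v,w) = 2 }, where N(·) denotes the neighbourhood in G. Then Gap(G) ≥ min{C*, 2} / (n − 1). -/

import Mathlib

open Classical in
/-- Transition matrix of the simple random walk on `G`:
`P v w = 1/deg(v)` if `v ~ w`, else `0`. -/
noncomputable def transitionMatrix {V : Type*} [Fintype V] (G : SimpleGraph V) :
    Matrix V V ℝ :=
  fun v w => if G.Adj v w then ((G.degree v : ℝ))⁻¹ else 0

/-- The second-largest eigenvalue of a matrix with real spectrum: the second-largest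
root (with multiplicity) of its characteristic polynomial. -/
noncomputable def lambda2 {V : Type*} [Fintype V] [DecidableEq V] (M : Matrix V V ℝ) : ℝ :=
  (M.charpoly.roots.sort (· ≤ ·)).getD ((M.charpoly.roots.sort (· ≤ ·)).length - 2) 0

open Classical in
/-- Spectral gap of the random walk on `G`; by convention `0` if some vertex is isolated. -/
noncomputable def spectralGap {V : Type*} [Fintype V] (G : SimpleGraph V) : ℝ :=
  if ∀ v, 0 < G.degree v then 1 - lambda2 (transitionMatrix G) else 0

open Classical in
theorem exists_pair_lambda2_le {V : Type*} [Fintype V] {S : Matrix V V ℝ} (hS : S.IsHermitian)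
    (hn : 2 ≤ Fintype.card V) :
    ∃ i j, i ≠ j ∧ lambda2 S ≤ hS.eigenvalues i ∧ lambda2 S ≤ hS.eigenvalues j := by
  set l := S.charpoly.roots.sort (· ≤ ·) with hl
  have hroots : (l : Multiset ℝ) = Finset.univ.val.map hS.eigenvalues := by
    rw [hl, Multiset.sort_eq, hS.roots_charpoly_eq_eigenvalues]
    rfl
  have hlen : l.length = Fintype.card V := by
    rw [← Multiset.coe_card, hroots]
    simp
  have hsorted : l.Pairwise (· ≤ ·) := Multiset.pairwise_sort _ _
  have hlt : l.length - 2 < l.length := by omega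
  have hlam : lambda2 S = l[l.length - 2] := by
    rw [lambda2, ← hl, List.getD_eq_getElem _ _ hlt]
  have hdrop : ∀ x ∈ l.drop (l.length - 2), lambda2 S ≤ x := by
    intro x hx
    obtain ⟨k, hk, rfl⟩ := List.mem_iff_getElem.1 hx
    rw [hlam, List.getElem_drop]
    exact hsorted.sortedLE.getElem_le_getElem_of_le (by omega)
  have hcount : 2 ≤ l.countP (fun x => decide (lambda2 S ≤ x)) := by
    calc 2 = (l.drop (l.length - 2)).length := by rw [List.length_drop]; omega
      _ = (l.drop (l.length - 2)).countP (fun x => decide (lambda2 S ≤ x)) :=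
        (List.countP_eq_length.2 (by simpa using hdrop)).symm
      _ ≤ _ := (List.drop_sublist _ _).countP_le
  have hcard : 1 < (Finset.univ.filter fun i => lambda2 S ≤ hS.eigenvalues i).card := by
    have h : (Finset.univ.filter fun i => lambda2 S ≤ hS.eigenvalues i).card =
        l.countP (fun x => decide (lambda2 S ≤ x)) := by
      rw [← Multiset.coe_countP, hroots, Multiset.countP_map]
      rfl
    omega
  obtain ⟨i, hi, j, hj, hij⟩ := Finset.one_lt_card.1 hcard
  exact ⟨i, j, hij, (Finset.mem_filter.1 hi).2, (Finset.mem_filter.1 hj).2⟩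

open Classical in
/-- The symmetric normalization `D^{-1/2} A D^{-1/2}` of the adjacency matrix. -/
noncomputable def normalizedAdjMatrix {V : Type*} [Fintype V] (G : SimpleGraph V) :
    Matrix V V ℝ :=
  Matrix.diagonal (fun v => (√(G.degree v : ℝ))⁻¹) * G.adjMatrix ℝ *
    Matrix.diagonal (fun v => (√(G.degree v : ℝ))⁻¹)

theorem normalizedAdjMatrix_isHermitian {V : Type*} [Fintype V] (G : SimpleGraph V) :
    (normalizedAdjMatrix G).IsHermitian := by
  classical
  ext v w
  simp only [normalizedAdjMatrix, Matrix.conjTranspose_apply, Matrix.mul_diagonal,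
    Matrix.diagonal_mul, SimpleGraph.adjMatrix_apply, star_trivial, G.adj_comm w v]
  ring

open Classical in
theorem transitionMatrix_eq_diagonal_mul {V : Type*} [Fintype V] (G : SimpleGraph V) :
    transitionMatrix G = Matrix.diagonal (fun v => (√(G.degree v : ℝ))⁻¹) *
      (Matrix.diagonal (fun v => (√(G.degree v : ℝ))⁻¹) * G.adjMatrix ℝ) := by
  ext v w
  simp only [transitionMatrix, Matrix.diagonal_mul, SimpleGraph.adjMatrix_apply]
  rw [← mul_assoc, ← mul_inv, Real.mul_self_sqrt (Nat.cast_nonneg _)]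
  simp

open Classical in
theorem lambda2_transitionMatrix {V : Type*} [Fintype V] (G : SimpleGraph V) :
    lambda2 (transitionMatrix G) = lambda2 (normalizedAdjMatrix G) := by
  rw [lambda2, lambda2, transitionMatrix_eq_diagonal_mul, Matrix.charpoly_mul_comm,
    normalizedAdjMatrix]

open Classical in
theorem transitionMatrix_mulVec_of_normalizedAdjMatrix {V : Type*} [Fintype V]
    (G : SimpleGraph V) {u : V → ℝ} {μ : ℝ}
    (hu : Matrix.mulVec (normalizedAdjMatrix G) u = μ • u) :
    Matrix.mulVec (transitionMatrix G)
      (Matrix.mulVec (Matrix.diagonal fun v => (√(G.degree v : ℝ))⁻¹) u) =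
      μ • Matrix.mulVec (Matrix.diagonal fun v => (√(G.degree v : ℝ))⁻¹) u := by
  rw [← Matrix.mulVec_smul, ← hu, Matrix.mulVec_mulVec, Matrix.mulVec_mulVec,
    transitionMatrix_eq_diagonal_mul, normalizedAdjMatrix]
  simp only [Matrix.mul_assoc]

open Classical in
theorem degree_mul_sub_transitionMatrix_mulVec {V : Type*} [Fintype V] (G : SimpleGraph V)
    (f : V → ℝ) {v : V} (hv : 0 < G.degree v) :
    f v - Matrix.mulVec (transitionMatrix G) f v =
      ∑ w ∈ G.neighborFinset v, (f v - f w) / G.degree v := by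
  have hv' : (G.degree v : ℝ) ≠ 0 := by positivity
  have h : Matrix.mulVec (transitionMatrix G) f v =
      ∑ w ∈ G.neighborFinset v, f w / G.degree v := by
    simp only [Matrix.mulVec, dotProduct, transitionMatrix, ite_mul, zero_mul,
      SimpleGraph.neighborFinset_eq_filter, Finset.sum_filter]
    exact Finset.sum_congr rfl fun w _ => by split_ifs <;> ring
  simp only [sub_div, Finset.sum_sub_distrib, h, Finset.sum_const,
    SimpleGraph.card_neighborFinset_eq_degree, nsmul_eq_mul, mul_div_cancel₀ _ hv']

open Classical in
/-- A non-constant eigenfunction of the walk has eigenvalue at most `1 - k / (n - 1)`, when `k ≤ 2`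
and any two distinct non-adjacent vertices have at least `k` common neighbours. -/
theorem le_one_sub_of_mulVec_eq_smul {V : Type*} [Fintype V] {G : SimpleGraph V} {k : ℕ}
    (hdeg : ∀ v, 0 < G.degree v) (hk : k ≤ 2)
    (hcommon : ∀ v w, v ≠ w → ¬ G.Adj v w →
      k ≤ (G.neighborFinset v ∩ G.neighborFinset w).card)
    {f : V → ℝ} {μ : ℝ} (hf : Matrix.mulVec (transitionMatrix G) f = μ • f)
    {a b : V} (hab : f a ≠ f b) :
    (k : ℝ) / ((Fintype.card V : ℝ) - 1) ≤ 1 - μ := by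
  have : Nonempty V := ⟨a⟩
  obtain ⟨x, hx⟩ := Finite.exists_max f
  obtain ⟨y, hy⟩ := Finite.exists_min f
  have hyx : f y < f x := by
    rcases lt_or_gt_of_ne hab with h | h
    · exact (hy a).trans_lt (h.trans_le (hx b))
    · exact (hy b).trans_lt (h.trans_le (hx a))
  have hne : x ≠ y := fun h => hyx.ne (by rw [h])
  set N : ℝ := (Fintype.card V : ℝ) - 1 with hN
  have hdN : ∀ v, (G.degree v : ℝ) ≤ N := by
    intro v
    have h : ((G.degree v + 1 : ℕ) : ℝ) ≤ Fintype.card V :=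
      Nat.cast_le.2 (G.degree_lt_card_verts v)
    push_cast at h
    linarith
  have hd0 : ∀ v, (0 : ℝ) < G.degree v := fun v => Nat.cast_pos.2 (hdeg v)
  have hN0 : 0 < N := (hd0 a).trans_le (hdN a)
  have hxeq : (1 - μ) * f x = ∑ w ∈ G.neighborFinset x, (f x - f w) / G.degree x := by
    rw [← degree_mul_sub_transitionMatrix_mulVec G f (hdeg x), hf]
    simp [sub_mul]
  have hyeq : -((1 - μ) * f y) = ∑ w ∈ G.neighborFinset y, (f w - f y) / G.degree y := by
    have h := degree_mul_sub_transitionMatrix_mulVec G f (hdeg y)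
    rw [hf] at h
    rw [← neg_inj, ← Finset.sum_neg_distrib, neg_neg]
    simp only [← neg_div, neg_sub, ← h, Pi.smul_apply, smul_eq_mul]
    ring
  have hxN : ∑ w ∈ G.neighborFinset x, (f x - f w) / N ≤ (1 - μ) * f x := by
    rw [hxeq]
    exact Finset.sum_le_sum fun w _ =>
      div_le_div_of_nonneg_left (sub_nonneg.2 (hx w)) (hd0 x) (hdN x)
  have hyN : ∑ w ∈ G.neighborFinset y, (f w - f y) / N ≤ -((1 - μ) * f y) := by
    rw [hyeq]
    exact Finset.sum_le_sum fun w _ =>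
      div_le_div_of_nonneg_left (sub_nonneg.2 (hy w)) (hd0 y) (hdN y)
  have hx0 : ∀ w, 0 ≤ (f x - f w) / N := fun w => div_nonneg (sub_nonneg.2 (hx w)) hN0.le
  have hy0 : ∀ w, 0 ≤ (f w - f y) / N := fun w => div_nonneg (sub_nonneg.2 (hy w)) hN0.le
  have hpos : 0 < f x - f y := sub_pos.2 hyx
  have key : (k : ℝ) * ((f x - f y) / N) ≤ (1 - μ) * (f x - f y) := by
    by_cases hadj : G.Adj x y
    · have h1 := Finset.single_le_sum (f := fun w => (f x - f w) / N) (fun w _ => hx0 w)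
        ((G.mem_neighborFinset x y).2 hadj)
      have h2 := Finset.single_le_sum (f := fun w => (f w - f y) / N) (fun w _ => hy0 w)
        ((G.mem_neighborFinset y x).2 hadj.symm)
      have hk' : (k : ℝ) ≤ 2 := by exact_mod_cast hk
      have h3 := mul_le_mul_of_nonneg_right hk' (hx0 y)
      linarith
    · have h1 := Finset.sum_le_sum_of_subset_of_nonneg
        (Finset.inter_subset_left (s₁ := G.neighborFinset x) (s₂ := G.neighborFinset y))
        (f := fun w => (f x - f w) / N) (fun w _ _ => hx0 w)
      have h2 := Finset.sum_le_sum_of_subset_of_nonneg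
        (Finset.inter_subset_right (s₁ := G.neighborFinset x) (s₂ := G.neighborFinset y))
        (f := fun w => (f w - f y) / N) (fun w _ _ => hy0 w)
      have h3 : ∑ w ∈ G.neighborFinset x ∩ G.neighborFinset y, (f x - f w) / N +
          ∑ w ∈ G.neighborFinset x ∩ G.neighborFinset y, (f w - f y) / N =
          ((G.neighborFinset x ∩ G.neighborFinset y).card : ℝ) * ((f x - f y) / N) := by
        rw [← Finset.sum_add_distrib, ← nsmul_eq_mul, ← Finset.sum_const]
        exact Finset.sum_congr rfl fun w _ => by ring
      have h4 := mul_le_mul_of_nonneg_right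
        (Nat.cast_le (α := ℝ).2 (hcommon x y hne hadj)) (hx0 y)
      linarith
  refine le_of_mul_le_mul_right ?_ hpos
  calc (k : ℝ) / N * (f x - f y) = k * ((f x - f y) / N) := by ring
    _ ≤ _ := key

open Classical in
/-- Among two orthogonal nonzero vectors, one is not a multiple of the square root of the degree. -/
theorem exists_ne_of_inner_eq_zero {V : Type*} [Fintype V] {G : SimpleGraph V}
    (hdeg : ∀ v, 0 < G.degree v) {u u' : EuclideanSpace ℝ V} (hu : u ≠ 0) (hu' : u' ≠ 0)
    (h : inner ℝ u u' = 0) :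
    (∃ a b, (√(G.degree a : ℝ))⁻¹ * u a ≠ (√(G.degree b : ℝ))⁻¹ * u b) ∨
      ∃ a b, (√(G.degree a : ℝ))⁻¹ * u' a ≠ (√(G.degree b : ℝ))⁻¹ * u' b := by
  by_contra! hcon
  obtain ⟨h1, h2⟩ := hcon
  obtain ⟨z, hz⟩ : ∃ z, u z ≠ 0 := by
    by_contra! h0
    exact hu (PiLp.ext h0)
  set r : EuclideanSpace ℝ V := WithLp.toLp 2 fun v => √(G.degree v : ℝ) with hr
  have hmul : ∀ t : EuclideanSpace ℝ V,
      (∀ a b, (√(G.degree a : ℝ))⁻¹ * t a = (√(G.degree b : ℝ))⁻¹ * t b) →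
      t = ((√(G.degree z : ℝ))⁻¹ * t z) • r := by
    intro t ht
    ext v
    have hv : √(G.degree v : ℝ) ≠ 0 := (Real.sqrt_pos.2 (Nat.cast_pos.2 (hdeg v))).ne'
    rw [ht z v]
    simp only [hr, PiLp.smul_apply, smul_eq_mul]
    field_simp
  have e1 := hmul u h1
  have e2 := hmul u' h2
  rw [e1, e2, real_inner_smul_left, real_inner_smul_right] at h
  rcases mul_eq_zero.1 h with h | h
  · exact hu (by rw [e1, h, zero_smul])
  rcases mul_eq_zero.1 h with h | h
  · exact hu' (by rw [e2, h, zero_smul])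
  · exact hu (by rw [e1, inner_self_eq_zero.1 h, smul_zero])

open Classical in
theorem div_le_one_sub_lambda2_transitionMatrix {V : Type*} [Fintype V] {G : SimpleGraph V} {k : ℕ}
    (hn : 2 ≤ Fintype.card V) (hdeg : ∀ v, 0 < G.degree v) (hk : k ≤ 2)
    (hcommon : ∀ v w, v ≠ w → ¬ G.Adj v w →
      k ≤ (G.neighborFinset v ∩ G.neighborFinset w).card) :
    (k : ℝ) / ((Fintype.card V : ℝ) - 1) ≤ 1 - lambda2 (transitionMatrix G) := by
  rw [lambda2_transitionMatrix]
  have hS := normalizedAdjMatrix_isHermitian G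
  obtain ⟨i, j, hij, hi, hj⟩ := exists_pair_lambda2_le hS hn
  have hbound : ∀ l, (∃ a b, (√(G.degree a : ℝ))⁻¹ * hS.eigenvectorBasis l a ≠
      (√(G.degree b : ℝ))⁻¹ * hS.eigenvectorBasis l b) →
      (k : ℝ) / ((Fintype.card V : ℝ) - 1) ≤ 1 - hS.eigenvalues l := by
    rintro l ⟨a, b, hab⟩
    refine le_one_sub_of_mulVec_eq_smul hdeg hk hcommon
      (transitionMatrix_mulVec_of_normalizedAdjMatrix G (hS.mulVec_eigenvectorBasis l))
      (a := a) (b := b) ?_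
    simpa only [Matrix.mulVec_diagonal] using hab
  have hne := fun l => hS.eigenvectorBasis.orthonormal.ne_zero l
  rcases exists_ne_of_inner_eq_zero hdeg (hne i) (hne j)
    (hS.eigenvectorBasis.orthonormal.inner_eq_zero hij) with h | h
  · linarith [hbound i h]
  · linarith [hbound j h]

open Classical in
/-- **Proposition 4.1.** If `G` is connected on `n` vertices with diameter exactly `2`,
and `C* = min{|N(v) ∩ N(w)| : dist(v,w) = 2}`, then `Gap(G) ≥ min(C*, 2)/(n-1)`. -/
theorem gap_of_diam_two {V : Type*} [Fintype V] (G : SimpleGraph V)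
    (hconn : G.Connected) (hdiam : G.diam = 2) (C : ℕ)
    (hC : C = sInf {k : ℕ | ∃ v w : V, G.dist v w = 2 ∧
      (G.neighborFinset v ∩ G.neighborFinset w).card = k}) :
    ((min C 2 : ℕ) : ℝ) / ((Fintype.card V : ℝ) - 1) ≤ spectralGap G := by
  have hnt : Nontrivial V := SimpleGraph.nontrivial_of_diam_ne_zero (G := G) (by omega)
  have hdeg : ∀ v, 0 < G.degree v := fun v => hconn.preconnected.degree_pos_of_nontrivial v
  rw [spectralGap, if_pos hdeg]
  refine div_le_one_sub_lambda2_transitionMatrix Fintype.one_lt_card hdeg (min_le_right _ _) ?_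
  intro v w hvw hadj
  have hle : G.dist v w ≤ 2 := by
    have := hconn.nonempty
    exact hdiam ▸ SimpleGraph.dist_le_diam (SimpleGraph.connected_iff_ediam_ne_top.1 hconn)
  have h0 : G.dist v w ≠ 0 := fun h => hvw (hconn.dist_eq_zero_iff.1 h)
  have h1 : G.dist v w ≠ 1 := fun h => hadj (SimpleGraph.dist_eq_one_iff_adj.1 h)
  exact (min_le_left _ _).trans (hC ▸ Nat.sInf_le ⟨v, w, by omega, rfl⟩)
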